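/- Let A ∈ Matrix (Fin n) (Fin n) ℂ be dissipative, i.e., every element of its numerical range W(A) has negative real part, and let Φ ∈ Matrix (Fin n) (Fin r) ℂ satisfy Φ*Φ = I_r with r ≥ 1. Then every eigenvalue of Φ*AΦ has negative real part; i.e., the Galerkin-reduced system matrix is stable. -/

import Mathlib

open Matrix

/-- Numerical range `W(M) = { v*Mv / v*v : v ≠ 0 }` of a square complex matrix. -/
def numRange {m : ℕ} (M : Matrix (Fin m) (Fin m) ℂ) : Set ℂ :=
  {z : ℂ | ∃ v : Fin m → ℂ, v ≠ 0 ∧ z = (star v ⬝ᵥ M.mulVec v) / (star v ⬝ᵥ v)}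

open scoped ComplexOrder in
/-- An eigenvalue of a square complex matrix lies in its numerical range. -/
theorem spectrum_subset_numRange {m : ℕ} (M : Matrix (Fin m) (Fin m) ℂ) :
    spectrum ℂ M ⊆ numRange M := by
  intro μ hμ
  rw [← Matrix.spectrum_toLin', ← Module.End.hasEigenvalue_iff_mem_spectrum] at hμ
  obtain ⟨v, hv⟩ := hμ.exists_hasEigenvector
  have hMv : M *ᵥ v = μ • v := by simpa using hv.apply_eq_smul
  refine ⟨v, hv.2, ?_⟩
  rw [hMv, dotProduct_smul, smul_eq_mul,
    mul_div_cancel_right₀ _ (dotProduct_star_self_eq_zero.not.mpr hv.2)]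

/-- Compression by a semiunitary matrix does not enlarge the numerical range. -/
theorem numRange_compression_subset {n r : ℕ} (A : Matrix (Fin n) (Fin n) ℂ)
    (Φ : Matrix (Fin n) (Fin r) ℂ) (hΦ : Φᴴ * Φ = 1) :
    numRange (Φᴴ * A * Φ) ⊆ numRange A := by
  rintro z ⟨v, hv, rfl⟩
  have hinv : Φᴴ *ᵥ (Φ *ᵥ v) = v := by rw [mulVec_mulVec, hΦ, one_mulVec]
  refine ⟨Φ *ᵥ v, fun h => hv (by rw [← hinv, h, mulVec_zero]), ?_⟩
  rw [star_mulVec, ← dotProduct_mulVec, ← dotProduct_mulVec, hinv, ← mulVec_mulVec,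
    ← mulVec_mulVec]

/-- If `A` is dissipative (its numerical range lies in the open left half-plane) and
`Φ` is semiunitary (`Φ*Φ = I`, `r ≥ 1`), then every eigenvalue of the Galerkin-reduced
matrix `Φ*AΦ` has negative real part: the reduced system is stable. -/
theorem stmt14 {n r : ℕ} (hr : 0 < r) (A : Matrix (Fin n) (Fin n) ℂ)
    (hA : ∀ z ∈ numRange A, z.re < 0)
    (Φ : Matrix (Fin n) (Fin r) ℂ) (hΦ : Φᴴ * Φ = 1) :
    ∀ μ ∈ spectrum ℂ (Φᴴ * A * Φ), μ.re < 0 := by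
  exact fun μ hμ =>
    hA μ (numRange_compression_subset A Φ hΦ (spectrum_subset_numRange _ hμ))
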